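/- arXiv:2603.02933 — 2 statements merged into one kernel-verified Lean document; each statement's English description precedes it below -/
import Mathlib

section
/- For every spin configuration σ ∈ {−1,+1}^N and every α ∈ [0,1], λ_max(J_HyIM(σ,α)) + λ_max((1−2α)D − W) ≥ 0; that is, the HyIM parameter gap Δ_HyIM(α) = (K/2)·[λ_max(J_HyIM(σ,α)) + λ_max((1−2α)D − W)] is nonnegative for every coupling strength K > 0. -/
open Matrix Finset

/-- Degree matrix `D = diag(d_1, …, d_N)` with `d_i = Σ_j W i j`. -/
noncomputable def degMat {N : ℕ} (W : Matrix (Fin N) (Fin N) ℝ) : Matrix (Fin N) (Fin N) ℝ :=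
  Matrix.diagonal (fun i => ∑ j, W i j)

/-- `μ` is the largest eigenvalue of `A`. -/
def IsMaxEig {N : ℕ} (A : Matrix (Fin N) (Fin N) ℝ) (μ : ℝ) : Prop :=
  (∃ v : Fin N → ℝ, v ≠ 0 ∧ A.mulVec v = μ • v) ∧
  ∀ ν : ℝ, (∃ v : Fin N → ℝ, v ≠ 0 ∧ A.mulVec v = ν • v) → ν ≤ μ

/-- DIM Jacobian. -/
noncomputable def JDIM {N : ℕ} (W : Matrix (Fin N) (Fin N) ℝ) (σ : Fin N → ℝ) :
    Matrix (Fin N) (Fin N) ℝ :=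
  fun i j => if i = j then ∑ k, σ i * σ k * W i k else σ i * σ j * W i j

/-- OIM Jacobian. -/
noncomputable def JOIM {N : ℕ} (W : Matrix (Fin N) (Fin N) ℝ) (σ : Fin N → ℝ) :
    Matrix (Fin N) (Fin N) ℝ :=
  fun i j => if i = j then ∑ k, σ i * σ k * W i k else -(σ i * σ j * W i j)

/-- HyIM Jacobian `J_HyIM(σ,α) = α·J_DIM(σ) + (1−α)·J_OIM(σ)`. -/
noncomputable def JHyIM {N : ℕ} (W : Matrix (Fin N) (Fin N) ℝ) (σ : Fin N → ℝ) (α : ℝ) :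
    Matrix (Fin N) (Fin N) ℝ :=
  α • JDIM W σ + (1 - α) • JOIM W σ

/-- Rayleigh bound: the quadratic form of a symmetric matrix is at most its largest eigenvalue
times the squared norm. -/
lemma IsMaxEig.dotProduct_mulVec_le {N : ℕ} {A : Matrix (Fin N) (Fin N) ℝ} {μ : ℝ}
    (h : IsMaxEig A μ) (hA : A.IsSymm) (v : Fin N → ℝ) :
    v ⬝ᵥ A *ᵥ v ≤ μ * (v ⬝ᵥ v) := by
  have hH : (μ • (1 : Matrix (Fin N) (Fin N) ℝ) - A).IsHermitian := by
    simp [Matrix.IsHermitian, hA.eq]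
  have hpos : (μ • (1 : Matrix (Fin N) (Fin N) ℝ) - A).PosSemidef := by
    refine hH.posSemidef_iff_eigenvalues_nonneg.2 fun i => ?_
    have hi := hH.mulVec_eigenvectorBasis i
    have hle := h.2 (μ - hH.eigenvalues i) ⟨hH.eigenvectorBasis i, fun h0 =>
      hH.eigenvectorBasis.toBasis.ne_zero i (by ext j; simpa using congrFun h0 j), by
        rw [sub_mulVec, smul_mulVec, one_mulVec] at hi
        rw [sub_smul, ← hi, sub_sub_cancel]⟩
    simpa using hle
  have := hpos.dotProduct_mulVec_nonneg v
  simpa [sub_mulVec, smul_mulVec, dotProduct_sub] using this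

lemma JHyIM_isSymm {N : ℕ} {W : Matrix (Fin N) (Fin N) ℝ} (hW : W.IsSymm) (σ : Fin N → ℝ)
    (α : ℝ) : (JHyIM W σ α).IsSymm := by
  ext i j
  rcases eq_or_ne i j with rfl | hij
  · rfl
  · simp [JHyIM, JDIM, JOIM, hij, hij.symm, hW.apply i j, mul_comm (σ i) (σ j)]

lemma smul_degMat_sub_isSymm {N : ℕ} {W : Matrix (Fin N) (Fin N) ℝ} (hW : W.IsSymm) (c : ℝ) :
    (c • degMat W - W).IsSymm := by
  simp [Matrix.IsSymm, degMat, hW.eq]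

lemma JHyIM_mulVec_spin {N : ℕ} {W : Matrix (Fin N) (Fin N) ℝ} (hdiag : ∀ i, W i i = 0)
    {σ : Fin N → ℝ} (hσ : ∀ i, σ i * σ i = 1) (α : ℝ) :
    JHyIM W σ α *ᵥ σ = -(((1 - 2 * α) • degMat W - W) *ᵥ σ) := by
  ext i
  have hJ : ∀ j, JHyIM W σ α i j * σ j =
      (if i = j then (∑ k, σ i * σ k * W i k) * σ i else 0) -
        (1 - 2 * α) * σ i * W i j := by
    intro j
    rcases eq_or_ne i j with rfl | hij
    · simp only [JHyIM, JDIM, JOIM, hdiag, Matrix.add_apply, Matrix.smul_apply, smul_eq_mul, if_true]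
      ring
    · simp only [JHyIM, JDIM, JOIM, hij, Matrix.add_apply, Matrix.smul_apply, smul_eq_mul,
        if_false]
      linear_combination (2 * α - 1) * σ i * W i j * hσ j
  have hs : (∑ k, σ i * σ k * W i k) * σ i = ∑ k, W i k * σ k := by
    rw [Finset.sum_mul]
    exact Finset.sum_congr rfl fun k _ => by linear_combination σ k * W i k * hσ i
  rw [mulVec, dotProduct, Finset.sum_congr rfl fun j _ => hJ j, Finset.sum_sub_distrib,
    Finset.sum_ite_eq, if_pos (Finset.mem_univ i), hs, ← Finset.mul_sum, sub_mulVec, smul_mulVec]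
  simp only [degMat, Pi.neg_apply, Pi.sub_apply, Pi.smul_apply, mulVec_diagonal, smul_eq_mul]
  simp only [mulVec, dotProduct]
  ring

/-- for every spin configuration `σ` and every `α ∈ [0,1]`,
`λ_max(J_HyIM(σ,α)) + λ_max((1−2α)D − W) ≥ 0`; that is, the HyIM parameter gap
`Δ_HyIM(α) = (K/2)·[λ_max(J_HyIM(σ,α)) + λ_max((1−2α)D − W)]` is nonnegative
for every coupling strength `K > 0`. -/
theorem stmt8 {N : ℕ} (hN : 0 < N) (W : Matrix (Fin N) (Fin N) ℝ)
    (hsymm : W.IsSymm) (h01 : ∀ i j, W i j = 0 ∨ W i j = 1)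
    (hdiag : ∀ i, W i i = 0)
    (σ : Fin N → ℝ) (hσ : ∀ i, σ i = 1 ∨ σ i = -1)
    (α : ℝ) (hα : α ∈ Set.Icc (0:ℝ) 1)
    (lam₁ lam₂ : ℝ)
    (hlam₁ : IsMaxEig (JHyIM W σ α) lam₁)
    (hlam₂ : IsMaxEig ((1 - 2*α) • degMat W - W) lam₂) :
    0 ≤ lam₁ + lam₂ ∧ ∀ K : ℝ, 0 < K → 0 ≤ (K/2) * (lam₁ + lam₂) := by
  have hsq : ∀ i, σ i * σ i = 1 := fun i => by rcases hσ i with h | h <;> simp [h]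
  have h₁ := hlam₁.dotProduct_mulVec_le (JHyIM_isSymm hsymm σ α) σ
  have h₂ := hlam₂.dotProduct_mulVec_le (smul_degMat_sub_isSymm hsymm _) σ
  have hpos : 0 < σ ⬝ᵥ σ := by
    simpa [dotProduct, hsq] using hN
  rw [JHyIM_mulVec_spin hdiag hsq, dotProduct_neg] at h₁
  have hsum : 0 ≤ lam₁ + lam₂ := nonneg_of_mul_nonneg_left (by linarith) hpos
  exact ⟨hsum, fun K hK => mul_nonneg (half_pos hK).le hsum⟩
end

section
/- Assume λ̃_i + c ≥ 0 for every i = 1,…,N and Δ_HyIM(α) > 0. Then for every real energy threshold h with h > H₀ (for example the k-th excited Ising level H^k), if the degree of synchronization satisfies S(v_max) > 1 − (h − H₀)/(N·Δ_HyIM(α)), then H(σ_max) < h. -/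
open Matrix Finset

/-- Antiferromagnetic Ising energy `H(σ) = (1/2)·σᵀWσ`. -/
noncomputable def isingH {N : ℕ} (W : Matrix (Fin N) (Fin N) ℝ) (σ : Fin N → ℝ) : ℝ :=
  (1/2) * (σ ⬝ᵥ W.mulVec σ)

theorem dotProduct_eq_sum_of_orthonormal {n : ℕ} (v : Fin n → Fin n → ℝ)
    (horth : ∀ i j, v i ⬝ᵥ v j = if i = j then (1 : ℝ) else 0) (x y : Fin n → ℝ) :
    x ⬝ᵥ y = ∑ i, (v i ⬝ᵥ x) * (v i ⬝ᵥ y) := by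
  have hV : Matrix.of v * (Matrix.of v)ᵀ = 1 := by
    ext i j
    rw [Matrix.one_apply, ← horth i j]
    rfl
  have hV' : (Matrix.of v)ᵀ * Matrix.of v = 1 := mul_eq_one_comm.mp hV
  calc x ⬝ᵥ y = x ⬝ᵥ ((Matrix.of v)ᵀ * Matrix.of v) *ᵥ y := by rw [hV', Matrix.one_mulVec]
    _ = (Matrix.of v *ᵥ x) ⬝ᵥ (Matrix.of v *ᵥ y) := by
      rw [← Matrix.mulVec_mulVec, Matrix.dotProduct_mulVec, Matrix.vecMul_transpose]
    _ = _ := rfl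

theorem dotProduct_mulVec_eq_sum_of_orthonormal {n : ℕ} {M : Matrix (Fin n) (Fin n) ℝ}
    (hM : M.IsSymm) (lam : Fin n → ℝ) (v : Fin n → Fin n → ℝ)
    (heig : ∀ i, M *ᵥ v i = lam i • v i)
    (horth : ∀ i j, v i ⬝ᵥ v j = if i = j then (1 : ℝ) else 0) (x : Fin n → ℝ) :
    x ⬝ᵥ M *ᵥ x = ∑ i, lam i * (v i ⬝ᵥ x) ^ 2 := by
  rw [dotProduct_eq_sum_of_orthonormal v horth]
  refine Finset.sum_congr rfl fun i _ => ?_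
  rw [Matrix.dotProduct_mulVec, ← Matrix.mulVec_transpose, hM.eq, heig, smul_dotProduct,
    smul_eq_mul]
  ring

theorem dotProduct_self_of_spin {n : ℕ} {σ : Fin n → ℝ} (hσ : ∀ i, σ i = 1 ∨ σ i = -1) :
    σ ⬝ᵥ σ = n := by
  have h : ∀ i, σ i * σ i = 1 := fun i => by rcases hσ i with h | h <;> simp [h]
  simp [dotProduct, h]

theorem isingH_eq_of_spin {n : ℕ} (W : Matrix (Fin n) (Fin n) ℝ) (a : ℝ) {σ : Fin n → ℝ}
    (hσ : ∀ i, σ i = 1 ∨ σ i = -1) :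
    isingH W σ = (1/2) * (a * ∑ i, ∑ j, W i j - σ ⬝ᵥ (a • degMat W - W) *ᵥ σ) := by
  have hD : σ ⬝ᵥ degMat W *ᵥ σ = ∑ i, ∑ j, W i j := by
    refine Finset.sum_congr rfl fun i _ => ?_
    rw [degMat, Matrix.mulVec_diagonal]
    rcases hσ i with h | h <;> simp [h]
  rw [isingH, Matrix.sub_mulVec, Matrix.smul_mulVec, dotProduct_sub, dotProduct_smul, hD,
    smul_eq_mul]
  ring

/-- dimension `N+1 ≥ 1`: under the same spectral setup as
Statement 16, with `λ̃_i + c ≥ 0` for all `i` and `Δ_HyIM(α) > 0`: for every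
energy threshold `h > H₀`, if
`S(v_max) > 1 − (h − H₀)/(N·Δ_HyIM(α))`, then `H(σ_max) < h`. -/
theorem stmt17 {N : ℕ} (W : Matrix (Fin (N+1)) (Fin (N+1)) ℝ)
    (hsymm : W.IsSymm) (h01 : ∀ i j, W i j = 0 ∨ W i j = 1)
    (hdiag : ∀ i, W i i = 0)
    (α : ℝ) (hα : α ∈ Set.Icc (0:ℝ) 1)
    (lam : Fin (N+1) → ℝ) (v : Fin (N+1) → Fin (N+1) → ℝ)
    (hmono : Monotone lam)
    (heig : ∀ i, ((1 - 2*α) • degMat W - W).mulVec (v i) = lam i • v i)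
    (horth : ∀ i j, v i ⬝ᵥ v j = if i = j then (1:ℝ) else 0)
    (σstar : Fin (N+1) → ℝ) (hspin : ∀ i, σstar i = 1 ∨ σstar i = -1)
    (hmin : ∀ σ : Fin (N+1) → ℝ, (∀ i, σ i = 1 ∨ σ i = -1) →
      isingH W σstar ≤ isingH W σ)
    (c : ℝ) (hc : IsMaxEig (JHyIM W σstar α) c)
    (hpos : ∀ i, 0 ≤ lam i + c)
    (hgap : 0 < (1/2) * (lam (Fin.last N) + c))
    (hvnz : ∀ i, v (Fin.last N) i ≠ 0)
    (h : ℝ) (hh : isingH W σstar < h)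
    (hS : 1 - (h - isingH W σstar) / ((N + 1 : ℝ) * ((1/2) * (lam (Fin.last N) + c)))
        < (1/(N + 1 : ℝ)) *
          ((v (Fin.last N)) ⬝ᵥ (fun i => Real.sign (v (Fin.last N) i)))^2) :
    isingH W (fun i => Real.sign (v (Fin.last N) i)) < h := by
  have hM : ((1 - 2*α) • degMat W - W).IsSymm :=
    ((Matrix.isSymm_diagonal _).smul _).sub hsymm
  set s : Fin (N+1) → ℝ := fun i => Real.sign (v (Fin.last N) i)
  have hs : ∀ i, s i = 1 ∨ s i = -1 := fun i =>
    (Real.sign_apply_eq_of_ne_zero _ (hvnz i)).symm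
  have hnorm : ∀ σ : Fin (N+1) → ℝ, (∀ i, σ i = 1 ∨ σ i = -1) →
      ∑ i, (v i ⬝ᵥ σ) ^ 2 = (N : ℝ) + 1 := fun σ hσ => by
    have := dotProduct_eq_sum_of_orthonormal v horth σ σ
    rw [dotProduct_self_of_spin hσ] at this
    push_cast at this
    simp only [this, sq]
  have hquad := dotProduct_mulVec_eq_sum_of_orthonormal hM lam v heig horth
  have hupper : ∑ i, lam i * (v i ⬝ᵥ σstar) ^ 2 ≤ lam (Fin.last N) * (N + 1) := by
    rw [← hnorm σstar hspin, Finset.mul_sum]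
    exact Finset.sum_le_sum fun i _ =>
      mul_le_mul_of_nonneg_right (hmono (Fin.le_last i)) (sq_nonneg _)
  have hlower : (lam (Fin.last N) + c) * (v (Fin.last N) ⬝ᵥ s) ^ 2
      ≤ ∑ i, lam i * (v i ⬝ᵥ s) ^ 2 + c * (N + 1) := by
    rw [← hnorm s hs, Finset.mul_sum, ← Finset.sum_add_distrib]
    simp only [← add_mul]
    exact Finset.single_le_sum (f := fun i => (lam i + c) * (v i ⬝ᵥ s) ^ 2)
      (fun i _ => mul_nonneg (hpos i) (sq_nonneg _)) (Finset.mem_univ _)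
  have hs_energy := isingH_eq_of_spin W (1 - 2*α) hs
  have hstar_energy := isingH_eq_of_spin W (1 - 2*α) hspin
  rw [hquad] at hs_energy hstar_energy
  have hN : (0 : ℝ) < N + 1 := by positivity
  have hsync : ((N : ℝ) + 1) * ((1/2) * (lam (Fin.last N) + c)) - (h - isingH W σstar)
      < (1/2) * (lam (Fin.last N) + c) * (v (Fin.last N) ⬝ᵥ s) ^ 2 := by
    have := mul_lt_mul_of_pos_left hS (mul_pos hN hgap)
    rw [mul_sub, mul_one, mul_div_cancel₀ _ (mul_pos hN hgap).ne'] at this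
    refine this.trans_eq ?_
    field_simp
  linarith
end
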